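/- arXiv:math/9602212 — 3 statements merged into one kernel-verified Lean document; each statement's English description precedes it below -/
import Mathlib

section
/- Let W be the full group of permutations of {1,…,r₀} commuting with ι (the Weyl group of SO(2r+1), U(2r+1) or U(2r), i.e. the case G ≠ SO(2r)). Then for every w ∈ W there exists w₁ ∈ W in standard form such that w ≡ w₁ (mod W_M), i.e. w·W_M = w₁·W_M. -/
/-!  Common framework: Weyl groups of classical groups, modeled as permutations of ℕ
supported on `{1,…,r₀}`, with the convention `i' = r₀ + 1 - i`. -/

/-- `IsWfull r₀ w`: `w` fixes every point outside `{1,…,r₀}` and commutes with the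
involution `ι : i ↦ r₀ + 1 - i` on `{1,…,r₀}`.  This is the full group of permutations
of `{1,…,r₀}` commuting with `ι` (the Weyl group of `SO(2r+1)`, `U(2r+1)` or `U(2r)`). -/
def IsWfull (r₀ : ℕ) (w : Equiv.Perm ℕ) : Prop :=
  (∀ i : ℕ, ¬(1 ≤ i ∧ i ≤ r₀) → w i = i) ∧
  (∀ i : ℕ, 1 ≤ i → i ≤ r₀ → w (r₀ + 1 - i) = r₀ + 1 - w i)

/-- The parity condition singling out the Weyl group of `SO(2r)`:
the number of indices `1 ≤ i ≤ r` with `w i > r` is even. -/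
def EvenCond (r : ℕ) (w : Equiv.Perm ℕ) : Prop :=
  Even (((Finset.Icc 1 r).filter (fun i => r < w i)).card)

/-- Membership in `W`; the proposition `so2r` indicates whether we are in the `SO(2r)`
case (where the parity condition is imposed on top of `IsWfull`). -/
def MemW (r r₀ : ℕ) (so2r : Prop) (w : Equiv.Perm ℕ) : Prop :=
  IsWfull r₀ w ∧ (so2r → EvenCond r w)

/-- Membership in `W_M`: an element of `W` with `w({1,…,n}) = {1,…,n}` and
`w({n+1,…,r₀−n}) = {n+1,…,r₀−n}`. -/
def MemWM (r r₀ n : ℕ) (so2r : Prop) (m : Equiv.Perm ℕ) : Prop :=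
  MemW r r₀ so2r m ∧
  (Finset.Icc 1 n).image (fun i => m i) = Finset.Icc 1 n ∧
  (Finset.Icc (n + 1) (r₀ - n)).image (fun i => m i) = Finset.Icc (n + 1) (r₀ - n)

/-- The left coset `w·{m | P m}`. -/
def coset (P : Equiv.Perm ℕ → Prop) (w : Equiv.Perm ℕ) : Set (Equiv.Perm ℕ) :=
  {x | ∃ m, P m ∧ x = w * m}

/-- `w` is in standard form: a product of pairwise disjoint transpositions
`∏ᵢ (aᵢ aᵢ') · ∏ᵢ (bᵢ cᵢ)(cᵢ' bᵢ')` with `aᵢ, bᵢ ∈ {1,…,n}` and `cᵢ ∈ {n+1,…,r₀−n}`.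
This is encoded pointwise: `w` belongs to the full group `W`, is an involution, every
moved point `i ∈ {1,…,n}` has `w i = i'` or `w i ∈ {n+1,…,r₀−n}`, and every moved
point `i ∈ {n+1,…,r₀−n}` has `w i ∈ {1,…,n}` or `w i ∈ {n',…,r₀}`. -/
def IsStandardForm (r₀ n : ℕ) (w : Equiv.Perm ℕ) : Prop :=
  IsWfull r₀ w ∧ w * w = 1 ∧
  (∀ i, 1 ≤ i → i ≤ n → w i ≠ i →
    (w i = r₀ + 1 - i ∨ (n + 1 ≤ w i ∧ w i ≤ r₀ - n))) ∧
  (∀ i, n + 1 ≤ i → i ≤ r₀ - n → w i ≠ i →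
    (w i ≤ n ∨ r₀ + 1 - n ≤ w i))

/-- The 4-cycle `(a b c d)` sending `a ↦ b ↦ c ↦ d ↦ a`. -/
def cycle4 (a b c d : ℕ) : Equiv.Perm ℕ :=
  Equiv.swap a b * Equiv.swap b c * Equiv.swap c d

/-- `w` is in reduced form: `w = w₁ w₂` with `w₁` in standard form, `w₂` disjoint from
`w₁`, and `w₂` either the identity, or (only in the `SO(2r)` case) a transposition
`(d₀ d₀')` with `n+1 ≤ d₀ ≤ r`, or a 4-cycle `(i₀ j₀' i₀' j₀)` with `1 ≤ i₀ ≤ n < j₀ ≤ r`. -/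
def IsReducedForm (r r₀ n : ℕ) (so2r : Prop) (w : Equiv.Perm ℕ) : Prop :=
  ∃ w₁ w₂ : Equiv.Perm ℕ,
    IsStandardForm r₀ n w₁ ∧ w = w₁ * w₂ ∧ Equiv.Perm.Disjoint w₁ w₂ ∧
    (w₂ = 1 ∨
      (so2r ∧
        ((∃ d₀, n + 1 ≤ d₀ ∧ d₀ ≤ r ∧ w₂ = Equiv.swap d₀ (r₀ + 1 - d₀)) ∨
         (∃ i₀ j₀, 1 ≤ i₀ ∧ i₀ ≤ n ∧ n < j₀ ∧ j₀ ≤ r ∧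
            w₂ = cycle4 i₀ (r₀ + 1 - j₀) (r₀ + 1 - i₀) j₀))))

/-- The vector `e_i : {1,…,r₀} → ℤ` with `e_i(i) = 1`, `e_i(i') = −1`, `0` elsewhere. -/
def evec (r₀ i : ℕ) : ℕ → ℤ :=
  fun k => if k = i then 1 else if k = r₀ + 1 - i then -1 else 0

/-- The simple root `α_i = e_i − e_{i+1}`. -/
def rootAlpha (r₀ i : ℕ) : ℕ → ℤ := evec r₀ i - evec r₀ (i + 1)

/-- The root `β = e_ℓ + e_{ℓ+1}`. -/
def rootBeta (r₀ l : ℕ) : ℕ → ℤ := evec r₀ l + evec r₀ (l + 1)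

/-- The action of `w` on root vectors: `(w·v)(k) = v(w⁻¹ k)`. -/
def pact (w : Equiv.Perm ℕ) (v : ℕ → ℤ) : ℕ → ℤ := fun k => v (w⁻¹ k)

/-- The set `X = {α_1,…,α_ℓ, β}`. -/
def Xset (r₀ l : ℕ) : Set (ℕ → ℤ) :=
  {v | (∃ i, 1 ≤ i ∧ i ≤ l ∧ v = rootAlpha r₀ i) ∨ v = rootBeta r₀ l}

/-- The set of short and long roots `{e_i, 2e_i : 1 ≤ i ≤ n}` from which `S₀` is drawn. -/
def ShortLong (r₀ n : ℕ) : Set (ℕ → ℤ) :=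
  {v | ∃ i, 1 ≤ i ∧ i ≤ n ∧ (v = evec r₀ i ∨ v = evec r₀ i + evec r₀ i)}

/-- `Σ_P^+ = {e_i ± e_j : 1 ≤ i ≤ n < j ≤ r} ∪ {e_i + e_j : 1 ≤ i < j ≤ n} ∪ S₀`. -/
def SigmaP (r r₀ n : ℕ) (S₀ : Set (ℕ → ℤ)) : Set (ℕ → ℤ) :=
  {v | ∃ i j, 1 ≤ i ∧ i ≤ n ∧ n < j ∧ j ≤ r ∧
        (v = evec r₀ i - evec r₀ j ∨ v = evec r₀ i + evec r₀ j)} ∪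
  {v | ∃ i j, 1 ≤ i ∧ i < j ∧ j ≤ n ∧ v = evec r₀ i + evec r₀ j} ∪ S₀

/-- Hypothesis (E): `w·α ∉ X` for every `α ∈ Σ_P^+`. -/
def HypE (r r₀ n l : ℕ) (S₀ : Set (ℕ → ℤ)) (w : Equiv.Perm ℕ) : Prop :=
  ∀ α ∈ SigmaP r r₀ n S₀, pact w α ∉ Xset r₀ l

/-- Hypothesis (L): `α_ℓ = w·α` for some `α ∈ Σ_P^+`; no other element of `X` is of the
form `w·α` with `α ∈ Σ_P^+`; and `w⁻¹·α_ℓ` is not of the form `e_i + e_j` with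
`1 ≤ i, j ≤ n`. -/
def HypL (r r₀ n l : ℕ) (S₀ : Set (ℕ → ℤ)) (w : Equiv.Perm ℕ) : Prop :=
  (∃ α ∈ SigmaP r r₀ n S₀, pact w α = rootAlpha r₀ l) ∧
  (∀ α ∈ SigmaP r r₀ n S₀, pact w α ∈ Xset r₀ l → pact w α = rootAlpha r₀ l) ∧
  ¬ ∃ i j, 1 ≤ i ∧ i ≤ n ∧ 1 ≤ j ∧ j ≤ n ∧
      pact w⁻¹ (rootAlpha r₀ l) = evec r₀ i + evec r₀ j

/-- The permutation `(1 r₀)(2 r₀−1)⋯(n n')`. -/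
def w0base (r₀ n : ℕ) : Equiv.Perm ℕ :=
  (((List.range n).map (fun i => Equiv.swap (i + 1) (r₀ - i))).prod)

namespace IsWfull

variable {r₀ : ℕ} {w v : Equiv.Perm ℕ}

theorem mem_range_iff (hw : IsWfull r₀ w) (i : ℕ) :
    (1 ≤ w i ∧ w i ≤ r₀) ↔ (1 ≤ i ∧ i ≤ r₀) := by
  constructor
  · intro h
    by_contra hi
    rw [hw.1 i hi] at h
    exact hi h
  · intro h
    by_contra hi
    have h2 := w.injective (hw.1 (w i) hi)
    rw [h2] at hi
    exact hi h

theorem mul (hw : IsWfull r₀ w) (hv : IsWfull r₀ v) : IsWfull r₀ (w * v) := by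
  refine ⟨fun i hi => ?_, fun i h1 h2 => ?_⟩
  · rw [Equiv.Perm.mul_apply, hv.1 i hi, hw.1 i hi]
  · have h := (hv.mem_range_iff i).2 ⟨h1, h2⟩
    rw [Equiv.Perm.mul_apply, Equiv.Perm.mul_apply, hv.2 i h1 h2, hw.2 _ h.1 h.2]

theorem inv (hw : IsWfull r₀ w) : IsWfull r₀ w⁻¹ := by
  refine ⟨fun i hi => ?_, fun i h1 h2 => ?_⟩
  · rw [Equiv.Perm.inv_eq_iff_eq, hw.1 i hi]
  · have h := (hw.mem_range_iff (w⁻¹ i)).1 (by simpa using ⟨h1, h2⟩)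
    rw [Equiv.Perm.inv_eq_iff_eq, hw.2 _ h.1 h.2]
    simp

end IsWfull

theorem Equiv.Perm.image_eq_self_iff {α : Type*} [DecidableEq α] (m : Equiv.Perm α)
    (s : Finset α) : s.image (fun i => m i) = s ↔ ∀ i, m i ∈ s ↔ i ∈ s := by
  constructor
  · intro h i
    constructor
    · intro hi
      rw [← h, Finset.mem_image] at hi
      obtain ⟨j, hj, hji⟩ := hi
      rwa [← m.injective hji]
    · intro hi
      rw [← h]
      exact Finset.mem_image_of_mem _ hi
  · intro h
    ext i
    rw [Finset.mem_image]
    constructor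
    · rintro ⟨j, hj, rfl⟩
      exact (h j).2 hj
    · intro hi
      exact ⟨m⁻¹ i, (h _).1 (by simpa using hi), by simp⟩

theorem memWM_iff {r r₀ n : ℕ} (hn : 2 * n ≤ r₀) (m : Equiv.Perm ℕ) :
    MemWM r r₀ n False m ↔
      IsWfull r₀ m ∧ ∀ i, (1 ≤ m i ∧ m i ≤ n) ↔ (1 ≤ i ∧ i ≤ n) := by
  unfold MemWM MemW
  rw [Equiv.Perm.image_eq_self_iff, Equiv.Perm.image_eq_self_iff]
  simp only [Finset.mem_Icc, false_imp_iff, and_true]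
  refine and_congr_right fun hm => and_iff_left_of_imp fun h i => ?_
  by_cases hi : 1 ≤ i ∧ i ≤ r₀
  · have h1 := h i
    have h2 := h (r₀ + 1 - i)
    have h3 := (hm.mem_range_iff i).2 hi
    rw [hm.2 i hi.1 hi.2] at h2
    omega
  · rw [hm.1 i hi]

theorem coset_eq_of_inv_mul_mem {r r₀ n : ℕ} (hn : 2 * n ≤ r₀) {w v : Equiv.Perm ℕ}
    (h : MemWM r r₀ n False (v⁻¹ * w)) :
    coset (MemWM r r₀ n False) w = coset (MemWM r r₀ n False) v := by
  rw [memWM_iff hn] at h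
  ext x
  constructor
  · rintro ⟨m, hm, rfl⟩
    rw [memWM_iff hn] at hm
    refine ⟨v⁻¹ * w * m, (memWM_iff hn _).2 ⟨h.1.mul hm.1, fun i => ?_⟩, by group⟩
    rw [Equiv.Perm.mul_apply, h.2, hm.2]
  · rintro ⟨m, hm, rfl⟩
    rw [memWM_iff hn] at hm
    refine ⟨(v⁻¹ * w)⁻¹ * m, (memWM_iff hn _).2 ⟨h.1.inv.mul hm.1, fun i => ?_⟩, by group⟩
    rw [← hm.2 i, ← h.2]
    simp

/-- Two finite sets of equal size have their differences exchanged by an involution. -/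
theorem Finset.exists_involution_sdiff {α : Type*} [DecidableEq α] {s t : Finset α}
    (hst : s.card = t.card) :
    ∃ h : α → α, (∀ x ∈ s, x ∉ t → h x ∈ t ∧ h x ∉ s ∧ h (h x) = x) ∧
      (∀ x ∈ t, x ∉ s → h x ∈ s ∧ h x ∉ t ∧ h (h x) = x) := by
  have e : {x // x ∈ s \ t} ≃ {x // x ∈ t \ s} :=
    Finset.equivOfCardEq (Finset.card_sdiff_comm hst)
  have he (x) (hx : x ∈ s \ t) := Finset.mem_sdiff.1 (e ⟨x, hx⟩).2
  have he' (x) (hx : x ∈ t \ s) := Finset.mem_sdiff.1 (e.symm ⟨x, hx⟩).2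
  refine ⟨fun x => if hx : x ∈ s \ t then e ⟨x, hx⟩ else
    if hx : x ∈ t \ s then e.symm ⟨x, hx⟩ else x, fun x hx hx' => ?_, fun x hx hx' => ?_⟩
  · have h1 : x ∈ s \ t := Finset.mem_sdiff.2 ⟨hx, hx'⟩
    have h2 := he x h1
    simp [hx, hx', h2]
  · have h1 : x ∈ t \ s := Finset.mem_sdiff.2 ⟨hx, hx'⟩
    have h2 := he' x h1
    simp [hx, hx', h2]

/-- A set `s` meeting each orbit of `i ↦ r₀ + 1 - i` at most once, of size `n` after folding
`{n',…,r₀}` onto `{1,…,n}`, is the image of `{1,…,n}` under a standard form element. -/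
theorem exists_isStandardForm {r₀ n : ℕ} (hn : 2 * n ≤ r₀) (s : ℕ → Prop) (T : Finset ℕ)
    (hs : ∀ x, s x → 1 ≤ x ∧ x ≤ r₀) (hs' : ∀ x, s x → ¬ s (r₀ + 1 - x))
    (hT : ∀ x, x ∈ T ↔ 1 ≤ x ∧ x ≤ r₀ - n ∧ (s x ∨ x ≤ n ∧ s (r₀ + 1 - x)))
    (hcard : T.card = n) :
    ∃ w : Equiv.Perm ℕ, IsStandardForm r₀ n w ∧ ∀ x, s (w x) ↔ 1 ≤ x ∧ x ≤ n := by
  classical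
  obtain ⟨h, hC, hD⟩ := Finset.exists_involution_sdiff (s := Finset.Icc 1 n) (t := T)
    (by simp [hcard])
  simp only [Finset.mem_Icc, hT] at hC hD
  let E : ℕ → Prop := fun x => (1 ≤ x ∧ x ≤ n ∧ ¬ s x ∧ ¬ s (r₀ + 1 - x)) ∨
    (n < x ∧ x ≤ r₀ - n ∧ s x)
  have hE (x) (hx : E x) : E (h x) ∧ h (h x) = x ∧ (x ≤ n → n < h x) ∧ (n < x → h x ≤ n) := by
    rcases hx with ⟨h1, h2, h3, h4⟩ | ⟨h1, h2, h3⟩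
    · obtain ⟨h5, h6, h7⟩ := hC x ⟨h1, h2⟩ (by tauto)
      refine ⟨.inr ⟨by omega, by omega, h5.2.2.resolve_right fun h => h6 (by omega)⟩, h7, ?_, ?_⟩ <;>
        omega
    · obtain ⟨h5, h6, h7⟩ := hD x ⟨by omega, h2, .inl h3⟩ (by omega)
      have h8 : h x ≤ r₀ - n := by omega
      refine ⟨.inl ⟨h5.1, h5.2, by tauto, by tauto⟩, h7, ?_, ?_⟩ <;> omega
  have hE' (x) (hx : E x) : ¬ E (r₀ + 1 - x) ∧ 1 ≤ x ∧ x ≤ r₀ - n := by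
    rcases hx with ⟨h1, h2, h3, h4⟩ | ⟨h1, h2, h3⟩
    · refine ⟨?_, h1, by omega⟩
      rintro (h | h) <;> omega
    · refine ⟨?_, by omega, h2⟩
      rintro (h | h)
      · omega
      · exact hs' x h3 h.2.2
  let B : ℕ → Prop := fun x => r₀ - n < x ∧ s x ∨ 1 ≤ x ∧ x ≤ n ∧ s (r₀ + 1 - x)
  have hB (x) (hx : B x) : ¬ E x ∧ ¬ E (r₀ + 1 - x) ∧ B (r₀ + 1 - x) ∧ 1 ≤ x ∧ x ≤ r₀ ∧
      (x ≤ n ∨ r₀ - n < x) := by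
    rcases hx with ⟨h1, h2⟩ | ⟨h1, h2, h3⟩
    · have h4 := hs x h2
      have h5 : s (r₀ + 1 - (r₀ + 1 - x)) := by rwa [Nat.sub_sub_self (by omega)]
      refine ⟨?_, ?_, .inr ⟨by omega, by omega, h5⟩, by omega, h4.2, .inr h1⟩
      · rintro (h | h) <;> omega
      · rintro (h | h)
        · exact h.2.2.2 h5
        · omega
    · refine ⟨?_, ?_, .inl ⟨by omega, h3⟩, h1, by omega, .inl h2⟩
      · rintro (h | h)
        · exact h.2.2.2 h3
        · omega
      · rintro (h | h) <;> omega
  have hι (x) (hx : x ≤ r₀) : r₀ + 1 - (r₀ + 1 - x) = x := by omega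
  have hsE (x) (h1 : s x) (h2 : ¬ E x) : x ≤ n ∨ B x := by
    by_contra! h3
    refine h2 (.inr ⟨h3.1, ?_, h1⟩)
    by_contra! h4
    exact h3.2 (.inl ⟨h4, h1⟩)
  have hns (x) (h1 : 1 ≤ x) (h2 : x ≤ n) (h3 : ¬ E x) (h4 : ¬ B x) : s x := by
    simp only [E, B] at h3 h4
    tauto
  have hsh (x) (h1 : E x) : (s (h x) ↔ x ≤ n) ∧ ¬ s (r₀ + 1 - h x) := by
    obtain ⟨h2, -, h3, h4⟩ := hE x h1
    rcases h2 with ⟨h5, h6, h7, h8⟩ | ⟨h5, h6, h7⟩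
    · refine ⟨iff_of_false h7 fun h => ?_, h8⟩
      have := h3 h
      omega
    · exact ⟨iff_of_true h7 (by omega), hs' _ h7⟩
  have hsB (x) (h1 : B x) : s (r₀ + 1 - x) ↔ x ≤ n := by
    have := hs' x
    rcases h1 with ⟨h2, h3⟩ | ⟨h2, h3, h4⟩
    · simp only [this h3, false_iff]
      omega
    · simp only [h3, h4]
  clear_value E B
  let f : ℕ → ℕ := fun x => if E x then h x
    else if 1 ≤ x ∧ x ≤ r₀ ∧ E (r₀ + 1 - x) then r₀ + 1 - h (r₀ + 1 - x)
    else if B x then r₀ + 1 - x else x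
  have f1 (x) (hx : E x) : f x = h x := if_pos hx
  have f2 (x) (h1 : 1 ≤ x) (h2 : x ≤ r₀) (hx : E (r₀ + 1 - x)) :
      f x = r₀ + 1 - h (r₀ + 1 - x) := by
    have := (hE' _ hx).1
    rw [hι x h2] at this
    simp [f, *]
  have f3 (x) (hx : B x) : f x = r₀ + 1 - x := by
    simp [f, hB x hx, hx]
  have f4 (x) (h1 : ¬ E x) (h2 : ¬ (1 ≤ x ∧ x ≤ r₀ ∧ E (r₀ + 1 - x))) (h3 : ¬ B x) :
      f x = x := by
    simp only [f, if_neg h1, if_neg h2, if_neg h3]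
  clear_value f
  have hcases (x) : E x ∨ (1 ≤ x ∧ x ≤ r₀ ∧ E (r₀ + 1 - x)) ∨ B x ∨
      (¬ E x ∧ ¬ (1 ≤ x ∧ x ≤ r₀ ∧ E (r₀ + 1 - x)) ∧ ¬ B x) := by
    tauto
  have hfι (x) (h1 : 1 ≤ x) (h2 : x ≤ r₀) : f (r₀ + 1 - x) = r₀ + 1 - f x := by
    have h3 := hι x h2
    rcases hcases x with hx | ⟨-, -, hx⟩ | hx | ⟨h4, h5, h6⟩
    · rw [f2 (r₀ + 1 - x) (by omega) (by omega) (by rwa [h3]), h3, f1 x hx]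
    · rw [f1 _ hx, f2 x h1 h2 hx, hι]
      have := hE' _ (hE _ hx).1
      omega
    · rw [f3 x hx, f3 _ (hB x hx).2.2.1]
    · rw [f4 x h4 h5 h6, f4]
      · tauto
      · rw [h3]
        tauto
      · intro h7
        have := (hB _ h7).2.2.1
        rw [h3] at this
        exact h6 this
  have hf : Function.Involutive f := by
    intro x
    rcases hcases x with hx | ⟨h1, h2, hx⟩ | hx | ⟨h4, h5, h6⟩
    · rw [f1 x hx, f1 _ (hE x hx).1, (hE x hx).2.1]
    · have h3 := hE' _ (hE _ hx).1
      rw [f2 x h1 h2 hx, hfι _ h3.2.1 (by omega), f1 _ (hE _ hx).1, (hE _ hx).2.1, hι x h2]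
    · rw [f3 x hx, f3 _ (hB x hx).2.2.1, hι x (by have := hB x hx; omega)]
    · rw [f4 x h4 h5 h6, f4 x h4 h5 h6]
  refine ⟨hf.toPerm, ⟨⟨fun i hi => ?_, hfι⟩, Equiv.ext hf, fun i h1 h2 h3 => ?_,
    fun i h1 h2 h3 => ?_⟩, fun x => ?_⟩
  · refine f4 i (fun h => ?_) (by tauto) (fun h => ?_)
    · have := hE' i h
      omega
    · have := hB i h
      omega
  · change f i = r₀ + 1 - i ∨ _ ≤ f i ∧ f i ≤ _
    change f i ≠ i at h3
    rcases hcases i with hx | ⟨-, -, hx⟩ | hx | ⟨h4, h5, h6⟩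
    · have h4 := hE i hx
      have h5 := hE' _ h4.1
      rw [f1 i hx]
      omega
    · have := hE' _ hx
      omega
    · exact .inl (f3 i hx)
    · exact absurd (f4 i h4 h5 h6) h3
  · change f i ≤ n ∨ _ ≤ f i
    change f i ≠ i at h3
    rcases hcases i with hx | ⟨-, -, hx⟩ | hx | ⟨h4, h5, h6⟩
    · have h4 := hE i hx
      rw [f1 i hx]
      omega
    · have h4 := hE _ hx
      rw [f2 i (by omega) (by omega) hx]
      omega
    · have := hB i hx
      omega
    · exact absurd (f4 i h4 h5 h6) h3
  · change s (f x) ↔ _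
    rcases hcases x with hx | ⟨h1, h2, hx⟩ | hx | ⟨h4, h5, h6⟩
    · have := hE' x hx
      rw [f1 x hx, (hsh x hx).1]
      omega
    · have := hE' _ hx
      rw [f2 x h1 h2 hx, iff_false_left (hsh _ hx).2]
      omega
    · have := hB x hx
      rw [f3 x hx, hsB x hx]
      omega
    · rw [f4 x h4 h5 h6]
      constructor
      · intro h7
        have := hs x h7
        have := hsE x h7 h4
        tauto
      · rintro ⟨h1, h2⟩
        exact hns x h1 h2 h4 h6

/-- in the full-group case (`G ≠ SO(2r)`), every `w ∈ W` is equivalent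
mod `W_M` to some `w₁ ∈ W` in standard form. -/
theorem stmt0 (r n ℓ r₀ : ℕ)
    (hn : 1 ≤ n) (hnl : n ≤ ℓ) (hlr : ℓ + 1 ≤ r)
    (hr₀ : r₀ = 2 * r ∨ r₀ = 2 * r + 1)
    (w : Equiv.Perm ℕ) (hw : MemW r r₀ False w) :
    ∃ w₁ : Equiv.Perm ℕ, IsStandardForm r₀ n w₁ ∧
      coset (MemWM r r₀ n False) w = coset (MemWM r r₀ n False) w₁ := by
  have hn2 : 2 * n ≤ r₀ := by omega
  have hwf : IsWfull r₀ w := hw.1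
  have hs (x) (hx : 1 ≤ w⁻¹ x ∧ w⁻¹ x ≤ n) : 1 ≤ x ∧ x ≤ r₀ :=
    (hwf.inv.mem_range_iff x).1 (by omega)
  let fold : ℕ → ℕ := fun x => if x ≤ r₀ - n then x else r₀ + 1 - x
  have hs' (x) (hx : 1 ≤ w⁻¹ x ∧ w⁻¹ x ≤ n) :
      ¬ (1 ≤ w⁻¹ (r₀ + 1 - x) ∧ w⁻¹ (r₀ + 1 - x) ≤ n) := by
    rw [hwf.inv.2 x (hs x hx).1 (hs x hx).2]
    omega
  obtain ⟨v, hv, hvs⟩ := exists_isStandardForm hn2 (fun x => 1 ≤ w⁻¹ x ∧ w⁻¹ x ≤ n)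
    ((Finset.Icc 1 n).image (fun i => fold (w i))) hs hs'
    (by
      intro x
      simp only [Finset.mem_image, Finset.mem_Icc, fold]
      constructor
      · rintro ⟨i, hi, rfl⟩
        have h1 := (hwf.mem_range_iff i).2 (by omega)
        split_ifs with h
        · exact ⟨h1.1, h, .inl (by simpa using hi)⟩
        · refine ⟨by omega, by omega, .inr ⟨by omega, ?_⟩⟩
          rw [Nat.sub_sub_self (by omega)]
          simpa using hi
      · rintro ⟨h1, h2, h | ⟨h3, h⟩⟩
        · exact ⟨_, h, by simp [h2]⟩
        · refine ⟨_, h, ?_⟩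
          have h4 : w (w⁻¹ (r₀ + 1 - x)) = r₀ + 1 - x := by simp
          rw [h4, if_neg (by omega)]
          omega)
    (by
      rw [Finset.card_image_of_injOn, Nat.card_Icc, Nat.add_sub_cancel]
      intro i hi j hj hij
      rw [Finset.coe_Icc, Set.mem_Icc] at hi hj
      have h1 := (hwf.mem_range_iff i).2 (by omega)
      have h2 := (hwf.mem_range_iff j).2 (by omega)
      have h3 := hs' (w i) (by simpa using hi)
      have h4 : w i = w j ∨ w j = r₀ + 1 - w i := by
        simp only [fold] at hij
        split_ifs at hij <;> omega
      rcases h4 with h4 | h4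
      · exact w.injective h4
      · rw [← h4] at h3
        exact absurd (by simpa using hj) h3)
  refine ⟨v, hv, coset_eq_of_inv_mul_mem hn2 ((memWM_iff hn2 _).2 ⟨hv.1.inv.mul hwf, fun i => ?_⟩)⟩
  rw [← hvs]
  simp
end

section
/- Let w ∈ W be in reduced form and satisfy Hypothesis (E). Then for every k with n+1 ≤ k ≤ ℓ, one has w(k) > n, i.e. w(k) ∉ {1,…,n}. -/
theorem perm_apply_inv {α : Type*} (w : Equiv.Perm α) (i : α) : w (w⁻¹ i) = i :=
  w.apply_symm_apply i

theorem evec_rev {r₀ c : ℕ} (h1 : 1 ≤ c) (h2 : c ≤ r₀) (hc : 2 * c ≠ r₀ + 1) :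
    evec r₀ (r₀ + 1 - c) = -evec r₀ c := by
  funext k
  simp only [evec, Pi.neg_apply]
  split_ifs <;> omega

theorem pact_evec {r₀ : ℕ} {w : Equiv.Perm ℕ} (hw : IsWfull r₀ w) {i : ℕ}
    (h1 : 1 ≤ i) (h2 : i ≤ r₀) : pact w (evec r₀ i) = evec r₀ (w i) := by
  funext k
  simp only [pact, evec, Equiv.Perm.inv_eq_iff_eq, hw.2 i h1 h2]

theorem IsWfull.inv_mem_range {r₀ : ℕ} {w : Equiv.Perm ℕ} (hw : IsWfull r₀ w) {i : ℕ}
    (h1 : 1 ≤ i) (h2 : i ≤ r₀) : 1 ≤ w⁻¹ i ∧ w⁻¹ i ≤ r₀ := by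
  by_contra h
  have hfix := hw.1 _ h
  rw [perm_apply_inv] at hfix
  exact h (hfix ▸ ⟨h1, h2⟩)

theorem IsWfull.inv_rev {r₀ : ℕ} {w : Equiv.Perm ℕ} (hw : IsWfull r₀ w) {i : ℕ}
    (h1 : 1 ≤ i) (h2 : i ≤ r₀) : w⁻¹ (r₀ + 1 - i) = r₀ + 1 - w⁻¹ i := by
  obtain ⟨h3, h4⟩ := hw.inv_mem_range h1 h2
  rw [Equiv.Perm.inv_eq_iff_eq, hw.2 _ h3 h4, perm_apply_inv]

theorem evec_add_mem_SigmaP {r r₀ n a b : ℕ} {S₀ : Set (ℕ → ℤ)} (ha : 1 ≤ a) (han : a ≤ n)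
    (hb : 1 ≤ b) (hbr : b ≤ r) (hab : a ≠ b) :
    evec r₀ a + evec r₀ b ∈ SigmaP r r₀ n S₀ := by
  refine Or.inl ?_
  by_cases hbn : b ≤ n
  · right
    rcases lt_or_gt_of_ne hab with h | h
    · exact ⟨a, b, ha, h, hbn, rfl⟩
    · exact ⟨b, a, hb, h, han, add_comm _ _⟩
  · exact Or.inl ⟨a, b, ha, han, by omega, hbr, Or.inr rfl⟩

theorem evec_sub_mem_SigmaP {r r₀ n a c : ℕ} {S₀ : Set (ℕ → ℤ)}
    (hr₀ : r₀ = 2 * r ∨ r₀ = 2 * r + 1) (ha : 1 ≤ a) (han : a ≤ n)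
    (hc : n < c) (hcr : c ≤ r₀) (hca : c ≠ r₀ + 1 - a) (hcc : 2 * c ≠ r₀ + 1) :
    evec r₀ a - evec r₀ c ∈ SigmaP r r₀ n S₀ := by
  by_cases h : c ≤ r
  · exact Or.inl (Or.inl ⟨a, c, ha, han, hc, h, Or.inl rfl⟩)
  · rw [sub_eq_add_neg, ← evec_rev (by omega) hcr hcc]
    exact evec_add_mem_SigmaP ha han (by omega) (by omega) (by omega)

/-- Under Hypothesis (E), a difference `e_a - e_c ∈ Σ_P^+` is not sent to a simple root. -/
theorem HypE.sub_notMem {r r₀ n ℓ i a c : ℕ} {S₀ : Set (ℕ → ℤ)} {w : Equiv.Perm ℕ}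
    (hw : IsWfull r₀ w) (hE : HypE r r₀ n ℓ S₀ w) (hi : 1 ≤ i) (hil : i ≤ ℓ)
    (ha : 1 ≤ a) (har : a ≤ r₀) (hc : 1 ≤ c) (hcr : c ≤ r₀) (hwa : w a = i)
    (hwc : w c = i + 1) : evec r₀ a - evec r₀ c ∉ SigmaP r r₀ n S₀ := by
  intro hmem
  refine hE _ hmem (Or.inl ⟨i, hi, hil, ?_⟩)
  change pact w (evec r₀ a) - pact w (evec r₀ c) = _
  rw [pact_evec hw ha har, pact_evec hw hc hcr, hwa, hwc, rootAlpha]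

theorem HypE.inv_succ_le {r r₀ n ℓ i : ℕ} {S₀ : Set (ℕ → ℤ)} {w : Equiv.Perm ℕ}
    (hr₀ : r₀ = 2 * r ∨ r₀ = 2 * r + 1) (hlr : ℓ + 1 ≤ r) (hw : IsWfull r₀ w)
    (hE : HypE r r₀ n ℓ S₀ w) (hi : 1 ≤ i) (hil : i ≤ ℓ) (h : w⁻¹ i ≤ n) :
    w⁻¹ (i + 1) ≤ n := by
  by_contra hlt
  obtain ⟨h1, h2⟩ := hw.inv_mem_range hi (by omega)
  obtain ⟨h3, h4⟩ := hw.inv_mem_range (i := i + 1) (by omega) (by omega)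
  refine hE.sub_notMem hw hi hil h1 h2 h3 h4 (by simp) (by simp)
    (evec_sub_mem_SigmaP hr₀ h1 h (by omega) h4 ?_ ?_)
  · rw [← hw.inv_rev hi (by omega)]
    intro heq
    have := w⁻¹.injective heq
    omega
  · intro heq
    have hrev := hw.inv_rev (i := i + 1) (by omega) (by omega)
    have := w⁻¹.injective (hrev.trans (by omega : _ = w⁻¹ (i + 1)))
    omega

theorem HypE.le_inv_of_le_inv_succ {r r₀ n ℓ i : ℕ} {S₀ : Set (ℕ → ℤ)} {w : Equiv.Perm ℕ}
    (hr₀ : r₀ = 2 * r ∨ r₀ = 2 * r + 1) (hlr : ℓ + 1 ≤ r) (hnr : n ≤ r) (hw : IsWfull r₀ w)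
    (hE : HypE r r₀ n ℓ S₀ w) (hi : 1 ≤ i) (hil : i ≤ ℓ) (h : r₀ + 1 - n ≤ w⁻¹ (i + 1)) :
    r₀ + 1 - n ≤ w⁻¹ i := by
  by_contra hlt
  obtain ⟨h1, h2⟩ := hw.inv_mem_range hi (by omega)
  obtain ⟨h3, h4⟩ := hw.inv_mem_range (i := i + 1) (by omega) (by omega)
  have hcc : 2 * w⁻¹ i ≠ r₀ + 1 := by
    intro heq
    have hrev := hw.inv_rev hi (by omega)
    have := w⁻¹.injective (hrev.trans (by omega : _ = w⁻¹ i))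
    omega
  have hne : w⁻¹ i ≠ r₀ + 1 - w⁻¹ (i + 1) := by
    rw [← hw.inv_rev (by omega) (by omega)]
    intro heq
    have := w⁻¹.injective heq
    omega
  refine hE.sub_notMem hw hi hil h1 h2 h3 h4 (by simp) (by simp) ?_
  have hmem : evec r₀ (r₀ + 1 - w⁻¹ (i + 1)) - evec r₀ (r₀ + 1 - w⁻¹ i) ∈ SigmaP r r₀ n S₀ :=
    evec_sub_mem_SigmaP hr₀ (by omega) (by omega) (by omega) (by omega) (by omega) (by omega)
  rwa [evec_rev h1 h2 hcc, evec_rev h3 h4 (by omega), neg_sub_neg] at hmem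

/-- Under Hypothesis (E), no index `k ≤ ℓ` has its preimage in `{1,…,n}`. -/
theorem HypE.lt_inv {r r₀ n ℓ k : ℕ} {S₀ : Set (ℕ → ℤ)} {w : Equiv.Perm ℕ}
    (hr₀ : r₀ = 2 * r ∨ r₀ = 2 * r + 1) (hlr : ℓ + 1 ≤ r) (hnr : n ≤ r) (hw : IsWfull r₀ w)
    (hE : HypE r r₀ n ℓ S₀ w) (hk : 1 ≤ k) (hkl : k ≤ ℓ) : n < w⁻¹ k := by
  by_contra! h
  have hprop : ∀ j, k ≤ j → j ≤ ℓ → w⁻¹ j ≤ n := by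
    intro j hj
    induction j, hj using Nat.le_induction with
    | base => exact fun _ => h
    | succ j hj ih =>
      exact fun hjl => hE.inv_succ_le hr₀ hlr hw (by omega) (by omega) (ih (by omega))
  have hl := hprop ℓ hkl le_rfl
  have hl' := hE.inv_succ_le hr₀ hlr hw (by omega) le_rfl hl
  obtain ⟨h1, h2⟩ := hw.inv_mem_range (i := ℓ) (by omega) (by omega)
  obtain ⟨h3, h4⟩ := hw.inv_mem_range (i := ℓ + 1) (by omega) (by omega)
  have hne : w⁻¹ ℓ ≠ w⁻¹ (ℓ + 1) := fun heq => by simpa using w⁻¹.injective heq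
  refine hE _ (evec_add_mem_SigmaP (r := r) h1 hl h3 (by omega) hne) (Or.inr ?_)
  change pact w (evec r₀ _) + pact w (evec r₀ _) = _
  rw [pact_evec hw h1 h2, pact_evec hw h3 h4, perm_apply_inv,
    perm_apply_inv, rootBeta]

/-- Under Hypothesis (E), no index in `{n+1,…,ℓ}` has its preimage in `{n',…,r₀}`. -/
theorem HypE.inv_lt {r r₀ n ℓ k : ℕ} {S₀ : Set (ℕ → ℤ)} {w : Equiv.Perm ℕ}
    (hr₀ : r₀ = 2 * r ∨ r₀ = 2 * r + 1) (hlr : ℓ + 1 ≤ r) (hnr : n ≤ r) (hw : IsWfull r₀ w)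
    (hE : HypE r r₀ n ℓ S₀ w) (hk : n + 1 ≤ k) (hkl : k ≤ ℓ) : w⁻¹ k < r₀ + 1 - n := by
  by_contra! h
  have hall : ∀ j, 1 ≤ j → j ≤ k → r₀ + 1 - n ≤ w⁻¹ j := by
    intro j hj hjk
    induction hjk using Nat.decreasingInduction with
    | self => exact h
    | of_succ m hm ih =>
      exact hE.le_inv_of_le_inv_succ hr₀ hlr hnr hw hj (by omega) (ih (by omega))
  have hcard : (Finset.Icc 1 k).card ≤ (Finset.Icc (r₀ + 1 - n) r₀).card := by
    refine Finset.card_le_card_of_injOn (fun j => w⁻¹ j) ?_ w⁻¹.injective.injOn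
    intro j hj
    obtain ⟨hj1, hjk⟩ := Finset.mem_Icc.mp hj
    exact Finset.mem_Icc.mpr ⟨hall j hj1 hjk, (hw.inv_mem_range hj1 (by omega)).2⟩
  simp only [Nat.card_Icc] at hcard
  omega

theorem apply_apply_of_disjoint {w₁ w₂ : Equiv.Perm ℕ} (hinv : w₁ * w₁ = 1)
    (hdisj : Equiv.Perm.Disjoint w₁ w₂) {k : ℕ} (hk : w₂ k = k) :
    (w₁ * w₂) ((w₁ * w₂) k) = k := by
  have h : w₁ (w₁ k) = k := DFunLike.congr_fun hinv k
  rw [Equiv.Perm.mul_apply w₁ w₂ k, hk, Equiv.Perm.mul_apply]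
  rcases hdisj (w₁ k) with h1 | h1
  · rw [← w₁.injective h1] at hk ⊢
    simp_all
  · rw [h1, h]

theorem cycle4_apply_of_ne {a b c d k : ℕ} (ha : k ≠ a) (hb : k ≠ b) (hc : k ≠ c) (hd : k ≠ d) :
    cycle4 a b c d k = k := by
  simp [cycle4, Equiv.swap_apply_of_ne_of_ne, *]

theorem cycle4_apply_third {a b c d : ℕ} (hda : d ≠ a) (hdb : d ≠ b) (hdc : d ≠ c) :
    cycle4 a b c d c = d := by
  simp [cycle4, Equiv.swap_apply_of_ne_of_ne, *]

/-- if `w ∈ W` is in reduced form and satisfies Hypothesis (E), then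
`w k > n` for all `n+1 ≤ k ≤ ℓ`. -/
theorem stmt5 (r n ℓ r₀ : ℕ) (so2r : Prop)
    (hn : 1 ≤ n) (hnl : n ≤ ℓ) (hlr : ℓ + 1 ≤ r)
    (hr₀ : r₀ = 2 * r ∨ r₀ = 2 * r + 1) (hso : so2r → r₀ = 2 * r)
    (S₀ : Set (ℕ → ℤ)) (hS₀ : S₀ ⊆ ShortLong r₀ n)
    (w : Equiv.Perm ℕ) (hw : MemW r r₀ so2r w)
    (hred : IsReducedForm r r₀ n so2r w)
    (hE : HypE r r₀ n ℓ S₀ w) :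
    ∀ k, n + 1 ≤ k → k ≤ ℓ → n < w k := by
  intro k hk hkl
  obtain ⟨hfull, -⟩ := hw
  obtain ⟨w₁, w₂, ⟨-, hinv, -, -⟩, rfl, hdisj, hw₂⟩ := hred
  have key : ∀ {x}, (w₁ * w₂) x = k → n < x ∧ x < r₀ + 1 - n := by
    intro x hx
    have hx' : (w₁ * w₂)⁻¹ k = x := by rw [Equiv.Perm.inv_eq_iff_eq, hx]
    rw [← hx']
    exact ⟨hE.lt_inv hr₀ hlr (by omega) hfull (by omega) hkl,
      hE.inv_lt hr₀ hlr (by omega) hfull hk hkl⟩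
  by_cases hfix : w₂ k = k
  · exact (key (apply_apply_of_disjoint hinv hdisj hfix)).1
  rcases hw₂ with rfl | ⟨-, ⟨d, hd, hdr, rfl⟩ | ⟨i, j, hi, hin, hj, hjr, rfl⟩⟩
  · exact absurd rfl hfix
  · have hkd : k = d := by
      by_contra hne
      exact hfix (Equiv.swap_apply_of_ne_of_ne hne (by omega))
    subst hkd
    have hw₁ : w₁ (r₀ + 1 - k) = r₀ + 1 - k :=
      (hdisj _).resolve_right (by rw [Equiv.swap_apply_right]; omega)
    rw [Equiv.Perm.mul_apply, Equiv.swap_apply_left, hw₁]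
    omega
  · have hkj : k = j := by
      by_contra hne
      exact hfix (cycle4_apply_of_ne (by omega) (by omega) (by omega) hne)
    subst hkj
    have hthird := cycle4_apply_third (a := i) (b := r₀ + 1 - k) (c := r₀ + 1 - i) (d := k)
      (by omega) (by omega) (by omega)
    have hw₁ : w₁ k = k := (hdisj k).resolve_right hfix
    have := (key (x := r₀ + 1 - i) (by rw [Equiv.Perm.mul_apply, hthird, hw₁])).2
    omega
end

section
/- Let w ∈ W be in reduced form and satisfy Hypothesis (E). If w(i) = i' for some i with 2 ≤ i ≤ n, then w(i−1) = (i−1)'. -/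
theorem IsWfull.mem_iff {r₀ : ℕ} {w : Equiv.Perm ℕ} (hw : IsWfull r₀ w) (i : ℕ) :
    (1 ≤ w i ∧ w i ≤ r₀) ↔ (1 ≤ i ∧ i ≤ r₀) := by
  constructor
  · intro h
    by_contra hi
    rw [hw.1 i hi] at h
    exact hi h
  · intro h
    by_contra hi
    have := w.injective (hw.1 (w i) hi)
    rw [this] at hi
    exact hi h

theorem pact_add (w : Equiv.Perm ℕ) (u v : ℕ → ℤ) :
    pact w (u + v) = pact w u + pact w v := rfl

theorem evec_conj {r₀ i : ℕ} (h2 : i ≤ r₀) (h : 2 * i ≠ r₀ + 1) :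
    evec r₀ (r₀ + 1 - i) = -evec r₀ i := by
  funext k
  simp only [evec, Pi.neg_apply]
  split_ifs <;> omega

theorem evec_add_evec_mem_SigmaP {r r₀ n i k : ℕ}
    (hr₀ : r₀ = 2 * r ∨ r₀ = 2 * r + 1) (S₀ : Set (ℕ → ℤ))
    (hi : 1 ≤ i) (hin : i ≤ n) (hk : 1 ≤ k) (hkn : k ≤ r₀ - n) (hki : k ≠ i)
    (hmid : 2 * k ≠ r₀ + 1) : evec r₀ i + evec r₀ k ∈ SigmaP r r₀ n S₀ := by
  rcases le_or_gt k n with hle | hgt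
  · rcases lt_or_gt_of_ne hki with hlt | hlt
    · exact Or.inl (Or.inr ⟨k, i, hk, hlt, hin, add_comm _ _⟩)
    · exact Or.inl (Or.inr ⟨i, k, hi, hlt, hle, rfl⟩)
  · rcases le_or_gt k r with hkr | hkr
    · exact Or.inl (Or.inl ⟨i, k, hi, hin, hgt, hkr, Or.inr rfl⟩)
    · refine Or.inl (Or.inl ⟨i, r₀ + 1 - k, hi, hin, by omega, by omega, Or.inl ?_⟩)
      rw [evec_conj (by omega) hmid, sub_neg_eq_add]

/-- An element in reduced form that sends `m ∈ {1,…,n}` into `{n',…,1'}` sends `m` to `m'`. -/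
theorem IsReducedForm.apply_eq_conj {r r₀ n : ℕ} {so2r : Prop} {w : Equiv.Perm ℕ}
    (hred : IsReducedForm r r₀ n so2r w) (hnr : n ≤ r) (hr : 2 * r ≤ r₀) {m : ℕ}
    (hm : 1 ≤ m) (hmn : m ≤ n) (hwm : r₀ - n < w m) : w m = r₀ + 1 - m := by
  obtain ⟨w₁, w₂, ⟨-, -, hstd, -⟩, rfl, hdis, hw₂⟩ := hred
  rw [Equiv.Perm.mul_apply] at hwm ⊢
  by_cases hfix : w₂ m = m
  · rw [hfix] at hwm ⊢
    rcases hstd m hm hmn (by omega) with h | h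
    · exact h
    · omega
  · have hw₁ : w₁ (w₂ m) = w₂ m :=
      (hdis (w₂ m)).resolve_right fun h => hfix (w₂.injective h)
    rw [hw₁] at hwm
    rcases hw₂ with rfl | ⟨-, ⟨d, hd, hdr, rfl⟩ | ⟨i, j, hi, hin, hj, hjr, rfl⟩⟩
    · exact absurd rfl hfix
    · exact absurd (Equiv.swap_apply_of_ne_of_ne (by omega) (by omega)) hfix
    · exfalso
      simp only [cycle4, Equiv.Perm.mul_apply, Equiv.swap_apply_def] at hwm hfix
      split_ifs at hwm hfix <;> omega

/-- if `w ∈ W` is in reduced form, satisfies Hypothesis (E), and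
`w i = i'` for some `2 ≤ i ≤ n`, then `w (i-1) = (i-1)'`. -/
theorem stmt8 (r n ℓ r₀ : ℕ) (so2r : Prop)
    (hn : 1 ≤ n) (hnl : n ≤ ℓ) (hlr : ℓ + 1 ≤ r)
    (hr₀ : r₀ = 2 * r ∨ r₀ = 2 * r + 1) (hso : so2r → r₀ = 2 * r)
    (S₀ : Set (ℕ → ℤ)) (hS₀ : S₀ ⊆ ShortLong r₀ n)
    (w : Equiv.Perm ℕ) (hw : MemW r r₀ so2r w)
    (hred : IsReducedForm r r₀ n so2r w)
    (hE : HypE r r₀ n ℓ S₀ w) :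
    ∀ i, 2 ≤ i → i ≤ n → w i = r₀ + 1 - i → w (i - 1) = r₀ + 1 - (i - 1) := by
  intro i hi hin hwi
  have hW := hw.1
  obtain ⟨k, hk⟩ := w.surjective (i - 1)
  have hkr : 1 ≤ k ∧ k ≤ r₀ := (hW.mem_iff k).1 (by omega)
  have hconj := hW.2 k hkr.1 hkr.2
  have hmid : 2 * k ≠ r₀ + 1 := by
    intro h
    rw [show r₀ + 1 - k = k by omega] at hconj
    omega
  have hki : k ≠ i := by
    rintro rfl
    omega
  have hlarge : r₀ - n < k := by
    by_contra hle
    refine hE _ (evec_add_evec_mem_SigmaP hr₀ S₀ (by omega : 1 ≤ i) hin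
      hkr.1 (by omega) hki hmid) (Or.inl ⟨i - 1, by omega, by omega, ?_⟩)
    rw [pact_add, pact_evec hW (by omega) (by omega), pact_evec hW hkr.1 hkr.2, hwi, hk,
      evec_conj (by omega) (by omega), rootAlpha, show i - 1 + 1 = i by omega]
    abel
  have := hred.apply_eq_conj (m := r₀ + 1 - k) (by omega) (by omega) (by omega) (by omega)
    (by omega)
  have hkeq : r₀ + 1 - k = i - 1 := by omega
  rw [← hkeq]
  exact this
end
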